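/- Suppose y ≤ w in S_d and i is cancellable for [y,w]. Then for any u, v with y ≤ u, v ≤ w, the Kazhdan-Lusztig polynomials satisfy P_{u,v} = P_{u^{î}, v^{î}}, where u^{î}, v^{î} in S_{d-1} are obtained by deleting position i. -/

import Mathlib

open Equiv Finset

/-- `inv_i(w) = |{i' < i : w(i') > w(i)}|`. -/
def invi {d : ℕ} (w : Perm (Fin d)) (i : Fin d) : ℕ :=
  (Finset.univ.filter (fun i' => i' < i ∧ w i < w i')).card

/-- `Inv_i(w) = |{i' > i : w(i') < w(i)}|`. -/
def Invi {d : ℕ} (w : Perm (Fin d)) (i : Fin d) : ℕ :=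
  (Finset.univ.filter (fun i' => i < i' ∧ w i' < w i)).card

/-- `s` is one of the standard Coxeter generators (adjacent transpositions) of `S_d`. -/
def IsAdjTrans {d : ℕ} (s : Perm (Fin d)) : Prop :=
  ∃ (i : ℕ) (h : i + 1 < d), s = Equiv.swap ⟨i, Nat.lt_of_succ_lt h⟩ ⟨i + 1, h⟩

/-- Coxeter length: minimal length of an expression of `w` as a product of
adjacent transpositions. -/
noncomputable def len {d : ℕ} (w : Perm (Fin d)) : ℕ :=
  sInf {n | ∃ l : List (Perm (Fin d)),
    l.length = n ∧ (∀ s ∈ l, IsAdjTrans s) ∧ l.prod = w}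

/-- Bruhat order: `y ≤ w` iff some reduced word for `w` has a subword with product `y`. -/
def BruhatLE {d : ℕ} (y w : Perm (Fin d)) : Prop :=
  ∃ l : List (Perm (Fin d)), (∀ s ∈ l, IsAdjTrans s) ∧ l.length = len w ∧ l.prod = w ∧
    ∃ l' : List (Perm (Fin d)), List.Sublist l' l ∧ l'.prod = y

open scoped Classical

/-- `x'` is the permutation `x^{î}` of `S_{d-1}` obtained from `x` by deleting position `i`
and value `x i`, renumbering order-preservingly: `x ∘ σ_i = σ_{x i} ∘ x'`. -/
def IsHat {d : ℕ} (i : Fin (d + 1)) (x : Perm (Fin (d + 1))) (x' : Perm (Fin d)) : Prop :=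
  ∀ j : Fin d, x (i.succAbove j) = (x i).succAbove (x' j)

/-- The Bruhat-minimum of `y` and `y·s` (these are always comparable). -/
noncomputable def bmin {d : ℕ} (y z : Perm (Fin d)) : Perm (Fin d) :=
  if BruhatLE y z then y else z

/-- `μ(z,w)`: the coefficient of `q^{(ℓ(w)-ℓ(z)-1)/2}` in `P_{z,w}`
(zero unless `ℓ(w) - ℓ(z)` is odd). -/
noncomputable def klmu {d : ℕ} (P : Perm (Fin d) → Perm (Fin d) → Polynomial ℤ)
    (z w : Perm (Fin d)) : ℤ :=
  if Odd (len w - len z) then (P z w).coeff ((len w - len z - 1) / 2) else 0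

/-- `P` is the family of Kazhdan–Lusztig polynomials of `S_d`: it satisfies
`P_{w,w} = 1`, `P_{y,w} = 0` unless `y ≤ w`, and the defining recursion
`P_{y,w} = P_{y',ws} + q P_{y's,ws} − Σ_{y ≤ z < ws, zs < z} μ(z,ws) q^{(ℓ(w)-ℓ(z))/2} P_{y,z}`
for any Coxeter generator `s` with `ws < w`, where `y' = min(y, ys)` in Bruhat order.
These conditions determine `P` uniquely. -/
noncomputable def IsKLFamily (d : ℕ)
    (P : Perm (Fin d) → Perm (Fin d) → Polynomial ℤ) : Prop :=
  (∀ w, P w w = 1) ∧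
  (∀ y w, ¬ BruhatLE y w → P y w = 0) ∧
  (∀ y w s, IsAdjTrans s → len (w * s) < len w →
    P y w = P (bmin y (y * s)) (w * s)
      + Polynomial.X * P (bmin y (y * s) * s) (w * s)
      - ∑ z ∈ Finset.univ.filter (fun z => BruhatLE y z ∧ BruhatLE z (w * s) ∧
            z ≠ w * s ∧ len (z * s) < len z),
          Polynomial.C (klmu P z (w * s)) * Polynomial.X ^ ((len w - len z) / 2) * P y z)

/-- Rank function: number of positions `j < p` with value at least `q`. -/
def rk {d : ℕ} (w : Perm (Fin d)) (p q : ℕ) : ℕ :=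
  ∑ j : Fin d, if j.val < p ∧ q ≤ (w j).val then 1 else 0

/-- Rank order. -/
def RLE {d : ℕ} (u v : Perm (Fin d)) : Prop := ∀ p q, rk u p q ≤ rk v p q

theorem adj_iff {d : ℕ} (s : Perm (Fin d)) :
    IsAdjTrans s ↔ ∃ k k1 : Fin d, k1.val = k.val + 1 ∧ s = swap k k1 := by
  constructor
  · rintro ⟨i, h, rfl⟩
    exact ⟨_, _, rfl, rfl⟩
  · rintro ⟨k, k1, h, rfl⟩
    refine ⟨k.val, by omega, ?_⟩
    congr 1
    exact Fin.ext h

theorem rk_succ {d : ℕ} (w : Perm (Fin d)) (p : Fin d) (q : ℕ) :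
    rk w (p.val + 1) q = rk w p.val q + if q ≤ (w p).val then 1 else 0 := by
  unfold rk
  have h : (if q ≤ (w p).val then 1 else 0) =
      ∑ j : Fin d, if j = p then (if q ≤ (w p).val then 1 else 0) else 0 := by simp
  rw [h, ← Finset.sum_add_distrib]
  apply Finset.sum_congr rfl
  intro j _
  by_cases hj : j = p
  · subst hj; simp
  · have : j.val ≠ p.val := fun h => hj (Fin.ext h)
    have e : (j.val < p.val + 1) ↔ j.val < p.val := by omega
    simp [hj, e]

theorem rk_swap_ne {d : ℕ} (w : Perm (Fin d)) (k k1 : Fin d) (hk : k1.val = k.val + 1)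
    (p q : ℕ) (hp : p ≠ k1.val) : rk (w * swap k k1) p q = rk w p q := by
  unfold rk
  rw [← Equiv.sum_comp (swap k k1) (fun j : Fin d => if j.val < p ∧ q ≤ (w j).val then 1 else 0)]
  apply Finset.sum_congr rfl
  intro j _
  have e : ((swap k k1) j).val < p ↔ j.val < p := by
    rw [swap_apply_def]
    split_ifs with h1 h2
    · subst h1; omega
    · subst h2; omega
    · rfl
  exact if_congr (and_congr e.symm Iff.rfl) rfl rfl

theorem rk_swap_eq {d : ℕ} (w : Perm (Fin d)) (k k1 : Fin d) (hk : k1.val = k.val + 1)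
    (q : ℕ) : rk (w * swap k k1) k1.val q = rk w k.val q + if q ≤ (w k1).val then 1 else 0 := by
  rw [hk, rk_succ, rk_swap_ne w k k1 hk _ _ (by omega)]
  simp

theorem rk_succ2 {d : ℕ} (w : Perm (Fin d)) (k k1 : Fin d) (hk : k1.val = k.val + 1)
    (q : ℕ) : rk w (k1.val + 1) q = rk w k.val q + (if q ≤ (w k).val then 1 else 0) +
      if q ≤ (w k1).val then 1 else 0 := by
  rw [rk_succ, hk, rk_succ]

theorem rle_refl {d : ℕ} (u : Perm (Fin d)) : RLE u u := fun _ _ => le_rfl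

theorem rle_trans {d : ℕ} {u v w : Perm (Fin d)} (h : RLE u v) (h' : RLE v w) : RLE u w :=
  fun p q => (h p q).trans (h' p q)

/-- lifting property -/
theorem rle_lift {d : ℕ} {u v : Perm (Fin d)} (k k1 : Fin d) (hk : k1.val = k.val + 1)
    (h : RLE u v) (hv : v k1 < v k) :
    (u k1 < u k → RLE (u * swap k k1) (v * swap k k1)) ∧
    (u k < u k1 → RLE u (v * swap k k1)) := by
  rw [Fin.lt_def] at hv
  have key : ∀ q, _ := fun q => (⟨h k.val q, h (k1.val+1) q⟩ : _ ∧ _)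
  simp only [rk_succ2 _ k k1 hk, rk_succ _ k] at key
  constructor
  · intro hu p q
    rw [Fin.lt_def] at hu
    by_cases hp : p = k1.val
    · subst hp
      rw [rk_swap_eq _ _ _ hk, rk_swap_eq _ _ _ hk]
      have := key q
      split_ifs at * <;> omega
    · rw [rk_swap_ne _ _ _ hk _ _ hp, rk_swap_ne _ _ _ hk _ _ hp]; exact h p q
  · intro hu p q
    rw [Fin.lt_def] at hu
    by_cases hp : p = k1.val
    · subst hp
      rw [rk_swap_eq _ _ _ hk, hk, rk_succ]
      have := key q
      split_ifs at * <;> omega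
    · rw [rk_swap_ne _ _ _ hk _ _ hp]; exact h p q

theorem rle_up {d : ℕ} {x w : Perm (Fin d)} (k k1 : Fin d) (hk : k1.val = k.val + 1)
    (h : RLE x w) (hw : w k < w k1) :
    RLE x (w * swap k k1) ∧ RLE (x * swap k k1) (w * swap k k1) := by
  rw [Fin.lt_def] at hw
  have key : ∀ q, _ := fun q => (⟨h k.val q, h (k.val+1) q, h (k1.val+1) q⟩ : _ ∧ _ ∧ _)
  simp only [rk_succ2 _ k k1 hk, rk_succ _ k] at key
  constructor
  · intro p q
    by_cases hp : p = k1.val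
    · subst hp
      rw [rk_swap_eq _ _ _ hk, hk, rk_succ]
      have := key q
      split_ifs at * <;> omega
    · rw [rk_swap_ne _ _ _ hk _ _ hp]; exact h p q
  · intro p q
    by_cases hp : p = k1.val
    · subst hp
      rw [rk_swap_eq _ _ _ hk, rk_swap_eq _ _ _ hk]
      have := key q
      split_ifs at * <;> omega
    · rw [rk_swap_ne _ _ _ hk _ _ hp, rk_swap_ne _ _ _ hk _ _ hp]; exact h p q

theorem rle_one {d : ℕ} {u : Perm (Fin d)} (h : RLE u 1) : u = 1 := by
  have hle : ∀ j, u j ≤ j := by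
    intro j
    by_contra hc
    have h1 := h (j.val + 1) (j.val + 1)
    have h2 : rk (1 : Perm (Fin d)) (j.val + 1) (j.val + 1) = 0 := by
      unfold rk
      apply Finset.sum_eq_zero
      intro x _
      rw [if_neg]
      simp
    rw [h2, rk_succ] at h1
    rw [not_le, Fin.lt_def] at hc
    rw [if_pos (by omega)] at h1
    omega
  have : ∀ n (j : Fin d), j.val = n → u j = j := by
    intro n
    induction n using Nat.strong_induction_on with
    | _ n ih =>
      intro j hj
      by_contra hc
      have hlt : u j < j := lt_of_le_of_ne (hle j) hc
      have := ih (u j).val (by rw [← hj]; exact hlt) (u j) rfl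
      exact hc (u.injective this)
  ext j
  rw [this _ j rfl]; rfl

theorem exists_desc {d : ℕ} {w : Perm (Fin d)} (hw : w ≠ 1) :
    ∃ k k1 : Fin d, k1.val = k.val + 1 ∧ w k1 < w k := by
  by_contra hc
  push Not at hc
  apply hw
  have hm : StrictMono w := by
    have hs : ∀ (n : ℕ) (a b : Fin d), b.val = a.val + n + 1 → w a < w b := by
      intro n
      induction n with
      | zero =>
        intro a b hab
        refine lt_of_le_of_ne (hc a b (by omega)) ?_
        intro h
        have := w.injective h
        rw [this] at hab; omega
      | succ n ih =>
        intro a b hab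
        let c : Fin d := ⟨a.val + n + 1, by omega⟩
        have h1 : w a < w c := ih a c rfl
        refine lt_of_lt_of_le h1 (hc c b ?_)
        change b.val = a.val + n + 1 + 1
        omega
    intro a b hab
    rw [Fin.lt_def] at hab
    exact hs (b.val - a.val - 1) a b (by omega)
  have h1 : w.symm = 1 := by
    apply rle_one
    have hid : ∀ j, w.symm j ≤ j := by
      intro j
      have := hm.le_apply (x := w.symm j)
      simpa using this
    intro p q
    unfold rk
    calc _ ≤ ∑ j : Fin d, (if j.val < p ∧ q ≤ ((1 : Perm (Fin d)) j).val then 1 else 0) := by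
          apply Finset.sum_le_sum
          intro j _
          have := hid j
          rw [Fin.le_def] at this
          have e1 : ((1 : Perm (Fin d)) j).val = j.val := rfl
          split_ifs <;> omega
      _ = _ := rfl
  ext j
  have := congrArg (fun f => f (w j)) h1
  simp at this
  simp [← this]

/-- number of inversions -/
def ninv {d : ℕ} (w : Perm (Fin d)) : ℕ :=
  ∑ b : Fin d, ∑ a : Fin d, if a < b ∧ w b < w a then 1 else 0

theorem ninv_one {d : ℕ} : ninv (1 : Perm (Fin d)) = 0 := by
  unfold ninv
  apply Finset.sum_eq_zero
  intro b _
  apply Finset.sum_eq_zero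
  intro a _
  rw [if_neg]
  simp only [Perm.one_apply]
  intro h
  exact absurd h.1 (not_lt.mpr h.2.le)

theorem ninv_swap {d : ℕ} (w : Perm (Fin d)) (k k1 : Fin d) (hk : k1.val = k.val + 1)
    (hw : w k < w k1) : ninv (w * swap k k1) = ninv w + 1 := by
  unfold ninv
  have e1 : ∑ b : Fin d, ∑ a : Fin d, (if a < b ∧ w b < w a then 1 else 0) =
      ∑ b : Fin d, ∑ a : Fin d, if (swap k k1) a < (swap k k1) b ∧
        w ((swap k k1) b) < w ((swap k k1) a) then 1 else 0 := by
    rw [← Equiv.sum_comp (swap k k1)]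
    apply Finset.sum_congr rfl
    intro b _
    rw [← Equiv.sum_comp (swap k k1)]
  have e2 : (1 : ℕ) = ∑ b : Fin d, ∑ a : Fin d, if (b = k1 ∧ a = k) then 1 else 0 := by
    rw [Finset.sum_eq_single k1]
    · simp
    · intro b _ hb; simp [hb]
    · simp
  rw [e1]
  refine Eq.trans ?_ (congrArg (HAdd.hAdd _) e2.symm)
  rw [← Finset.sum_add_distrib]
  apply Finset.sum_congr rfl
  intro b _
  rw [← Finset.sum_add_distrib]
  apply Finset.sum_congr rfl
  intro a _
  have hkk : k ≠ k1 := by intro h; rw [h] at hk; omega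
  have hlt : k < k1 := by rw [Fin.lt_def]; omega
  by_cases hab : b = k1 ∧ a = k
  · obtain ⟨rfl, rfl⟩ := hab
    simp [hlt, hw, hlt.le]
  by_cases hab' : b = k ∧ a = k1
  · obtain ⟨rfl, rfl⟩ := hab'
    simp [hw.not_gt, hlt.not_gt, hkk]
  have e : (swap k k1) a < (swap k k1) b ↔ a < b := by
    simp only [swap_apply_def]
    split_ifs <;> simp only [Fin.lt_def, Fin.ext_iff] at * <;> omega
  rw [if_neg hab, add_zero]
  exact if_congr (and_congr e.symm Iff.rfl) rfl rfl

theorem mul_swap_swap {d : ℕ} (w : Perm (Fin d)) (k k1 : Fin d) :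
    w * swap k k1 * swap k k1 = w := by
  rw [mul_assoc, swap_mul_self, mul_one]

theorem ninv_swap' {d : ℕ} (w : Perm (Fin d)) (k k1 : Fin d) (hk : k1.val = k.val + 1)
    (hw : w k1 < w k) : ninv w = ninv (w * swap k k1) + 1 := by
  have := ninv_swap (w * swap k k1) k k1 hk (by simpa using hw)
  rwa [mul_swap_swap] at this

theorem desc_or {d : ℕ} (w : Perm (Fin d)) (k k1 : Fin d) (hk : k1.val = k.val + 1) :
    w k < w k1 ∨ w k1 < w k := by
  apply lt_or_gt_of_ne
  intro h
  have := w.injective h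
  rw [this] at hk; omega

theorem exists_word {d : ℕ} : ∀ (n : ℕ) (w : Perm (Fin d)), ninv w = n →
    ∃ l : List (Perm (Fin d)), l.length = n ∧ (∀ s ∈ l, IsAdjTrans s) ∧ l.prod = w := by
  intro n
  induction n with
  | zero =>
    intro w hw
    refine ⟨[], rfl, by simp, ?_⟩
    by_contra hc
    obtain ⟨k, k1, hk, h⟩ := exists_desc (w := w) (fun h => hc (by simp [h]))
    have := ninv_swap' w k k1 hk h
    omega
  | succ n ih =>
    intro w hw
    have hne : w ≠ 1 := by
      rintro rfl
      rw [ninv_one] at hw; omega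
    obtain ⟨k, k1, hk, h⟩ := exists_desc hne
    have := ninv_swap' w k k1 hk h
    obtain ⟨l, h1, h2, h3⟩ := ih (w * swap k k1) (by omega)
    refine ⟨l ++ [swap k k1], by simp [h1], ?_, ?_⟩
    · intro s hs
      rcases List.mem_append.mp hs with hs | hs
      · exact h2 s hs
      · rw [List.mem_singleton.mp hs, adj_iff]
        exact ⟨k, k1, hk, rfl⟩
    · rw [List.prod_append, h3, List.prod_singleton, mul_swap_swap]

theorem ninv_word {d : ℕ} (l : List (Perm (Fin d))) : (∀ s ∈ l, IsAdjTrans s) →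
    ninv l.prod ≤ l.length := by
  induction l using List.reverseRecOn with
  | nil => intro _; simp [ninv_one]
  | append_singleton l s ih =>
    intro h
    have h1 := ih (fun t ht => h t (by simp [ht]))
    obtain ⟨k, k1, hk, rfl⟩ := (adj_iff s).mp (h s (by simp))
    rw [List.prod_append, List.prod_singleton, List.length_append, List.length_singleton]
    rcases desc_or l.prod k k1 hk with hd | hd
    · rw [ninv_swap _ _ _ hk hd]; omega
    · have := ninv_swap' _ _ _ hk hd; omega

theorem len_eq {d : ℕ} (w : Perm (Fin d)) : len w = ninv w := by
  unfold len
  apply le_antisymm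
  · exact Nat.sInf_le (exists_word _ w rfl)
  · have hne : {n | ∃ l : List (Perm (Fin d)),
        l.length = n ∧ (∀ s ∈ l, IsAdjTrans s) ∧ l.prod = w}.Nonempty :=
      ⟨_, exists_word _ w rfl⟩
    obtain ⟨l, h0, h, h1⟩ := Nat.sInf_mem hne
    rw [← h0]
    nth_rewrite 1 [← h1]
    exact ninv_word l h

theorem rle_of_bruhat_aux {d : ℕ} (l : List (Perm (Fin d))) : (∀ s ∈ l, IsAdjTrans s) →
    l.length = ninv l.prod → ∀ l' : List (Perm (Fin d)), List.Sublist l' l →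
    RLE l'.prod l.prod := by
  induction l using List.reverseRecOn with
  | nil => intro _ _ l' h; rw [List.sublist_nil.mp h]; exact rle_refl _
  | append_singleton l s ih =>
    intro h hlen l' hl'
    have hl : ∀ t ∈ l, IsAdjTrans t := fun t ht => h t (by simp [ht])
    obtain ⟨k, k1, hk, rfl⟩ := (adj_iff s).mp (h s (by simp))
    have hle := ninv_word l hl
    rw [List.prod_append, List.prod_singleton] at *
    rw [List.length_append, List.length_singleton] at hlen
    have hd : l.prod k < l.prod k1 := by
      rcases desc_or l.prod k k1 hk with hd | hd
      · exact hd
      · have := ninv_swap' _ _ _ hk hd; omega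
    have h2 := ninv_swap _ _ _ hk hd
    have ih' := ih hl (by omega)
    obtain ⟨a, b, rfl, ha, hb⟩ := List.sublist_append_iff.mp hl'
    have h3 := rle_up k k1 hk (ih' a ha) hd
    rw [List.prod_append]
    have hb' : b = [] ∨ b = [swap k k1] := by
      rcases List.sublist_cons_iff.mp hb with h | ⟨r, rfl, h⟩
      · exact Or.inl (List.sublist_nil.mp h)
      · rw [List.sublist_nil.mp h]; exact Or.inr rfl
    rcases hb' with rfl | rfl
    · simpa using h3.1
    · simpa using h3.2

theorem bruhat_of_rle {d : ℕ} : ∀ (n : ℕ) (u v : Perm (Fin d)), ninv v = n → RLE u v →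
    BruhatLE u v := by
  intro n
  induction n using Nat.strong_induction_on with
  | _ n ih =>
    intro u v hv h
    by_cases h1 : v = 1
    · subst h1
      have := rle_one h
      subst this
      refine ⟨[], by simp, ?_, rfl, [], by simp, rfl⟩
      rw [len_eq, ninv_one]; rfl
    · obtain ⟨k, k1, hk, hd⟩ := exists_desc h1
      have hn := ninv_swap' _ _ _ hk hd
      have hl := rle_lift k k1 hk h hd
      have hadj : ∀ l : List (Perm (Fin d)), (∀ s ∈ l, IsAdjTrans s) →
          ∀ s ∈ l ++ [swap k k1], IsAdjTrans s := by
        intro l h2 s hs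
        rcases List.mem_append.mp hs with hs | hs
        · exact h2 s hs
        · rw [List.mem_singleton.mp hs, adj_iff]
          exact ⟨k, k1, hk, rfl⟩
      rcases desc_or u k k1 hk with hu | hu
      · obtain ⟨l, a1, a2, a3, l', a4, a5⟩ := ih _ (by omega) u (v * swap k k1) rfl (hl.2 hu)
        refine ⟨l ++ [swap k k1], hadj l a1, ?_, ?_, l', ?_, a5⟩
        · rw [len_eq] at *; simp; omega
        · simp [a3]
        · exact a4.trans (List.sublist_append_left _ _)
      · obtain ⟨l, a1, a2, a3, l', a4, a5⟩ :=
          ih _ (by omega) (u * swap k k1) (v * swap k k1) rfl (hl.1 hu)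
        refine ⟨l ++ [swap k k1], hadj l a1, ?_, ?_, l' ++ [swap k k1], ?_, ?_⟩
        · rw [len_eq] at *; simp; omega
        · simp [a3]
        · exact a4.append (List.Sublist.refl _)
        · simp [a5]

theorem bruhat_iff {d : ℕ} (u v : Perm (Fin d)) : BruhatLE u v ↔ RLE u v := by
  constructor
  · rintro ⟨l, h1, h2, rfl, l', h3, rfl⟩
    exact rle_of_bruhat_aux l h1 (by rw [h2, len_eq]) l' h3
  · exact bruhat_of_rle _ u v rfl

theorem bruhat_len {d : ℕ} {u v : Perm (Fin d)} (h : BruhatLE u v) : len u ≤ len v := by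
  obtain ⟨l, h1, h2, rfl, l', h3, rfl⟩ := h
  rw [← h2, len_eq]
  exact (ninv_word l' (fun s hs => h1 s (h3.subset hs))).trans h3.length_le

theorem len_desc {d : ℕ} (w : Perm (Fin d)) (k k1 : Fin d) (hk : k1.val = k.val + 1) :
    len (w * swap k k1) < len w ↔ w k1 < w k := by
  rw [len_eq, len_eq]
  constructor
  · intro h
    rcases desc_or w k k1 hk with hu | hu
    · rw [ninv_swap _ _ _ hk hu] at h; omega
    · exact hu
  · intro h
    have := ninv_swap' _ _ _ hk h; omega

/-- relation of `invi` to ranks -/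
theorem invi_eq_rk {d : ℕ} (w : Perm (Fin d)) (i : Fin d) :
    invi w i = rk w i.val ((w i).val + 1) := by
  unfold invi rk
  rw [Finset.card_filter]
  apply Finset.sum_congr rfl
  intro j _
  simp only [Fin.lt_def, Nat.succ_le_iff]

theorem invi_eq_rk' {d : ℕ} (w : Perm (Fin d)) (i : Fin d) :
    invi w i = rk w i.val (w i).val := by
  unfold invi rk
  rw [Finset.card_filter]
  apply Finset.sum_congr rfl
  intro j _
  have : j < i → w j ≠ w i := by
    intro h h'
    exact absurd (w.injective h') h.ne
  have h2 : (j < i ∧ w i < w j) ↔ (j.val < i.val ∧ (w i).val ≤ (w j).val) := by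
    constructor
    · rintro ⟨a, b⟩; exact ⟨a, le_of_lt b⟩
    · rintro ⟨a, b⟩; exact ⟨a, lt_of_le_of_ne b (Ne.symm (this a))⟩
  simp only [h2]

theorem sandwich {d : ℕ} {y u w : Perm (Fin d)} {i : Fin d} (h1 : BruhatLE y u)
    (h2 : BruhatLE u w) (hv : y i = w i) (hi : invi y i = invi w i) :
    u i = w i ∧ invi u i = invi w i := by
  rw [bruhat_iff] at h1 h2
  have y1 := invi_eq_rk y i
  have y2 := invi_eq_rk' y i
  have w1 := invi_eq_rk w i
  have w2 := invi_eq_rk' w i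
  rw [hv] at y1 y2
  have a1 := h1 i.val (w i).val
  have a2 := h2 i.val (w i).val
  have b1 := h1 i.val ((w i).val + 1)
  have b2 := h2 i.val ((w i).val + 1)
  have c1 := h1 (i.val + 1) (w i).val
  have c2 := h2 (i.val + 1) (w i).val
  have d1 := h1 (i.val + 1) ((w i).val + 1)
  have d2 := h2 (i.val + 1) ((w i).val + 1)
  rw [rk_succ, rk_succ] at c1 c2 d1 d2
  rw [hv] at c1 d1
  have key : u i = w i := by
    apply Fin.ext
    split_ifs at * <;> omega
  refine ⟨key, ?_⟩
  rw [invi_eq_rk, key]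
  omega

theorem sa_val {d : ℕ} (i : Fin (d + 1)) (j : Fin d) :
    (i.succAbove j).val = if j.val < i.val then j.val else j.val + 1 := by
  simp only [Fin.succAbove, Fin.lt_def, Fin.val_castSucc]
  split_ifs <;> simp

theorem hat_exists {d : ℕ} (i : Fin (d + 1)) (x : Perm (Fin (d + 1))) :
    ∃ x' : Perm (Fin d), IsHat i x x' := by
  have h : ∀ j : Fin d, ∃ k : Fin d, (x i).succAbove k = x (i.succAbove j) := by
    intro j
    apply Fin.exists_succAbove_eq
    intro h
    exact Fin.succAbove_ne i j (x.injective h)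
  choose f hf using h
  have inj : Function.Injective f := by
    intro a b hab
    have : x (i.succAbove a) = x (i.succAbove b) := by rw [← hf, ← hf, hab]
    exact Fin.succAbove_right_injective (x.injective this)
  exact ⟨Equiv.ofBijective f (Finite.injective_iff_bijective.mp inj), fun j => (hf j).symm⟩

theorem hat_unique {d : ℕ} {i : Fin (d + 1)} {x : Perm (Fin (d + 1))} {a b : Perm (Fin d)}
    (ha : IsHat i x a) (hb : IsHat i x b) : a = b := by
  ext j
  have : (x i).succAbove (a j) = (x i).succAbove (b j) := by rw [← ha, ← hb]
  rw [Fin.succAbove_right_injective this]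

theorem hat_unique' {d : ℕ} {i : Fin (d + 1)} {x y : Perm (Fin (d + 1))} {a : Perm (Fin d)}
    (hxy : x i = y i) (hx : IsHat i x a) (hy : IsHat i y a) : x = y := by
  apply Equiv.ext
  intro j
  rcases Fin.eq_self_or_eq_succAbove i j with rfl | ⟨k, rfl⟩
  · exact hxy
  · rw [hx, hy, hxy]

theorem hat_lift {d : ℕ} (i a : Fin (d + 1)) (x' : Perm (Fin d)) :
    ∃ x : Perm (Fin (d + 1)), x i = a ∧ IsHat i x x' := by
  have h1 : ((finSuccEquiv' i).trans ((optionCongr x').trans (finSuccEquiv' a).symm)) i = a := by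
    simp
  refine ⟨_, h1, ?_⟩
  intro j
  rw [h1]
  simp

theorem rk_hat {d : ℕ} {i : Fin (d + 1)} {x : Perm (Fin (d + 1))} {x' : Perm (Fin d)}
    (h : IsHat i x x') (p q : ℕ) :
    rk x p q = (if i.val < p ∧ q ≤ (x i).val then 1 else 0) +
      rk x' (if p ≤ i.val then p else p - 1) (if q ≤ (x i).val then q else q - 1) := by
  unfold rk
  rw [Fin.sum_univ_succAbove _ i]
  congr 1
  apply Finset.sum_congr rfl
  intro j _
  rw [h j, sa_val, sa_val]
  congr 1
  apply propext
  split_ifs <;> omega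

theorem bruhat_hat {d : ℕ} {i : Fin (d + 1)} {u v : Perm (Fin (d + 1))} {u' v' : Perm (Fin d)}
    (huv : u i = v i) (hu : IsHat i u u') (hv : IsHat i v v') :
    BruhatLE u v ↔ BruhatLE u' v' := by
  rw [bruhat_iff, bruhat_iff]
  constructor
  · intro h p q
    have := h (if p ≤ i.val then p else p + 1) (if q ≤ (v i).val then q else q + 1)
    rw [rk_hat hu, rk_hat hv, huv] at this
    have e1 : ∀ a b : ℕ, (if (if a ≤ b then a else a + 1) ≤ b then (if a ≤ b then a else a + 1)
        else (if a ≤ b then a else a + 1) - 1) = a := by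
      intro a b; split_ifs <;> omega
    rw [e1, e1] at this
    omega
  · intro h p q
    rw [rk_hat hu, rk_hat hv, huv]
    exact Nat.add_le_add_left (h _ _) _

theorem len_hat {d : ℕ} {i : Fin (d + 1)} {x : Perm (Fin (d + 1))} {x' : Perm (Fin d)}
    (h : IsHat i x x') : len x + i.val = len x' + (2 * invi x i + (x i).val) := by
  have e1 : ninv x = invi x i + (Invi x i + ninv x') := by
    unfold ninv invi Invi
    rw [Fin.sum_univ_succAbove _ i, Finset.card_filter, Finset.card_filter,
      Fin.sum_univ_succAbove (fun i' => if i < i' ∧ x i' < x i then 1 else 0) i,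
      if_neg (by simp), zero_add, ← Finset.sum_add_distrib]
    congr 1
    apply Finset.sum_congr rfl
    intro b _
    rw [Fin.sum_univ_succAbove _ i]
    congr 1
    apply Finset.sum_congr rfl
    intro a _
    rw [h a, h b]
    exact if_congr (and_congr (Fin.strictMono_succAbove i).lt_iff_lt
      (Fin.strictMono_succAbove (x i)).lt_iff_lt) rfl rfl
  have e2 : Invi x i + i.val = invi x i + (x i).val := by
    have hI : ∀ c : Fin (d + 1), (Finset.univ.filter (fun j => j < c)).card = c.val := by
      intro c
      have : Finset.univ.filter (fun j => j < c) = Finset.Iio c := by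
        ext j; simp
      rw [this, Fin.card_Iio]
    have c1 : ∑ j : Fin (d + 1), (if x j < x i then 1 else 0) = (x i).val := by
      rw [Equiv.sum_comp x (fun j => if j < x i then 1 else 0), ← Finset.card_filter]
      exact hI _
    have c2 : ∑ j : Fin (d + 1), (if j < i then 1 else 0) = i.val := by
      rw [← Finset.card_filter]
      exact hI _
    refine (congrArg (HAdd.hAdd _) c2.symm).trans (Eq.trans ?_ (congrArg (HAdd.hAdd _) c1))
    unfold invi Invi
    rw [Finset.card_filter, Finset.card_filter, ← Finset.sum_add_distrib,
      ← Finset.sum_add_distrib]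
    apply Finset.sum_congr rfl
    intro j _
    rcases lt_trichotomy j i with hj | hj | hj
    · have : x j ≠ x i := fun hh => hj.ne (x.injective hh)
      rcases lt_or_gt_of_ne this with h' | h'
      · simp [hj, h', hj.not_gt, h'.not_gt]
      · simp [hj, h', hj.not_gt, h'.not_gt]
    · subst hj; simp
    · have : x j ≠ x i := fun hh => hj.ne' (x.injective hh)
      rcases lt_or_gt_of_ne this with h' | h'
      · simp [hj, h', hj.not_gt, h'.not_gt]
      · simp [hj, h', hj.not_gt, h'.not_gt]
  rw [len_eq, len_eq, e1]
  omega

theorem len_sub_hat {d : ℕ} {i : Fin (d + 1)} {u v : Perm (Fin (d + 1))} {u' v' : Perm (Fin d)}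
    (huv : u i = v i) (hi : invi u i = invi v i) (hu : IsHat i u u') (hv : IsHat i v v') :
    len v - len u = len v' - len u' := by
  have h1 := len_hat hu
  have h2 := len_hat hv
  rw [huv, hi] at h1
  omega

theorem len_lt_hat {d : ℕ} {i : Fin (d + 1)} {u v : Perm (Fin (d + 1))} {u' v' : Perm (Fin d)}
    (huv : u i = v i) (hi : invi u i = invi v i) (hu : IsHat i u u') (hv : IsHat i v v') :
    len v < len u ↔ len v' < len u' := by
  have h1 := len_hat hu
  have h2 := len_hat hv
  rw [huv, hi] at h1
  omega

theorem bmin_desc {d : ℕ} {u s : Perm (Fin d)} (h : len (u * s) < len u) :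
    bmin u (u * s) = u * s := by
  unfold bmin
  rw [if_neg]
  intro hb
  have := bruhat_len hb
  omega

/-- One step of the recursion when `u` is not below `v s`. -/
theorem kl_step {d : ℕ} {P : Perm (Fin d) → Perm (Fin d) → Polynomial ℤ}
    (hP : IsKLFamily d P) {u v : Perm (Fin d)} (k k1 : Fin d) (hk : k1.val = k.val + 1)
    (hv : v k1 < v k) (hu : u k1 < u k) (hn : ¬ BruhatLE u (v * swap k k1)) :
    P u v = P (u * swap k k1) (v * swap k k1) := by
  rw [hP.2.2 u v (swap k k1) ((adj_iff _).mpr ⟨k, k1, hk, rfl⟩) ((len_desc v k k1 hk).mpr hv),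
    bmin_desc ((len_desc u k k1 hk).mpr hu), mul_swap_swap, hP.2.1 _ _ hn, mul_zero, add_zero,
    Finset.sum_eq_zero, sub_zero]
  intro z hz
  exfalso
  rw [Finset.mem_filter] at hz
  apply hn
  have h1 := hz.2.1
  have h2 := hz.2.2.1
  rw [bruhat_iff] at *
  exact rle_trans h1 h2

/-- moving the cancelled position along an adjacent transposition -/
theorem hat_move {d : ℕ} {u : Perm (Fin (d + 1))} {u' : Perm (Fin d)} (a b : Fin (d + 1))
    (hab : b.val = a.val + 1 ∨ a.val = b.val + 1) (h : IsHat a u u') :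
    IsHat b (u * swap a b) u' := by
  intro j
  rw [Perm.mul_apply, Perm.mul_apply, swap_apply_right, ← h j]
  congr 1
  rw [swap_apply_def]
  apply Fin.ext
  split_ifs with h1 h2
  · rw [Fin.ext_iff] at h1
    rw [sa_val] at *
    split_ifs at * <;> omega
  · rw [Fin.ext_iff] at h2
    rw [sa_val] at *
    split_ifs at * <;> omega
  · rw [Fin.ext_iff] at h1 h2
    rw [sa_val] at *
    rw [sa_val]
    split_ifs at * <;> omega

/-- multiplying by an adjacent transposition away from `i` -/
theorem hat_mul {d : ℕ} {u : Perm (Fin (d + 1))} {u' : Perm (Fin d)} (i : Fin (d + 1))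
    (a b : Fin d) (h : IsHat i u u') :
    IsHat i (u * swap (i.succAbove a) (i.succAbove b)) (u' * swap a b) := by
  intro j
  have hi : swap (i.succAbove a) (i.succAbove b) i = i :=
    swap_apply_of_ne_of_ne (Fin.succAbove_ne i a).symm (Fin.succAbove_ne i b).symm
  rw [Perm.mul_apply, Perm.mul_apply, Perm.mul_apply, hi, ← h,
    (Fin.succAbove_right_injective (p := i)).swap_apply]

theorem invi_mul {d : ℕ} (u : Perm (Fin d)) (i k k1 : Fin d) (hk : k1.val = k.val + 1)
    (h1 : i ≠ k) (h2 : i ≠ k1) :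
    (u * swap k k1) i = u i ∧ invi (u * swap k k1) i = invi u i := by
  have e : (u * swap k k1) i = u i := by
    rw [Perm.mul_apply, swap_apply_of_ne_of_ne h1 h2]
  refine ⟨e, ?_⟩
  rw [invi_eq_rk, invi_eq_rk, e, rk_swap_ne _ _ _ hk]
  intro h
  exact h2 (Fin.ext h)

theorem main_aux (d : ℕ)
    (P : Perm (Fin (d + 1)) → Perm (Fin (d + 1)) → Polynomial ℤ)
    (P' : Perm (Fin d) → Perm (Fin d) → Polynomial ℤ)
    (hP : IsKLFamily (d + 1) P) (hP' : IsKLFamily d P') :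
    ∀ (n : ℕ) (u v : Perm (Fin (d + 1))) (i : Fin (d + 1)) (u' v' : Perm (Fin d)),
      len v = n → u i = v i → invi u i = invi v i → IsHat i u u' → IsHat i v v' →
      P u v = P' u' v' := by
  intro n
  induction n using Nat.strong_induction_on with
  | _ n ih =>
  intro u v i u' v' hn huv hinv hu hv
  by_cases hle : BruhatLE u v
  swap
  · rw [hP.2.1 _ _ hle, hP'.2.1]
    rwa [← bruhat_hat huv hu hv]
  by_cases hv1 : v = 1
  · subst hv1
    have : u = 1 := rle_one ((bruhat_iff _ _).mp hle)
    subst this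
    have := hat_unique hu hv
    subst this
    rw [hP.1, hP'.1]
  have hr := (bruhat_iff _ _).mp hle
  have iu := invi_eq_rk u i
  have iv := invi_eq_rk v i
  obtain ⟨k, k1, hk, hd⟩ := exists_desc hv1
  have hld := (len_desc v k k1 hk).mpr hd
  by_cases hik : i = k
  · -- move from `k` to `k1`
    subst hik
    have hd' := hd
    rw [Fin.lt_def] at hd'
    have hui : u k1 < u i := by
      rcases desc_or u i k1 hk with hh | hh
      · exfalso
        rw [Fin.lt_def] at hh
        have := hr (k1.val + 1) ((v i).val + 1)
        rw [rk_succ, rk_succ, hk, rk_succ, rk_succ] at this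
        rw [huv] at *
        split_ifs at this <;> omega
      · exact hh
    have hnb : ¬ BruhatLE u (v * swap i k1) := by
      intro hb
      have := (bruhat_iff _ _).mp hb k1.val (v i).val
      rw [rk_swap_eq _ _ _ hk, hk, rk_succ, ← invi_eq_rk', ← huv, ← invi_eq_rk', huv] at this
      split_ifs at this <;> omega
    rw [kl_step hP i k1 hk hd hui hnb]
    refine ih _ (by omega) _ _ k1 u' v' rfl ?_ ?_ (hat_move i k1 (Or.inl hk) hu)
      (hat_move i k1 (Or.inl hk) hv)
    · simpa using huv
    · rw [invi_eq_rk, invi_eq_rk, rk_swap_eq _ _ _ hk, rk_swap_eq _ _ _ hk]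
      simp only [Perm.mul_apply, swap_apply_right]
      rw [Fin.lt_def] at hui
      rw [if_neg (by omega), if_neg (by omega)]
      omega
  by_cases hik1 : i = k1
  · subst hik1
    have hd' := hd
    rw [Fin.lt_def] at hd'
    have hrs : ∀ x : Perm (Fin (d + 1)), ∀ q, rk x i.val q =
      rk x k.val q + if q ≤ (x k).val then 1 else 0 := by
      intro x q; rw [hk, rk_succ]
    have hui : u i < u k := by
      rcases desc_or u k i hk with hh | hh
      · exfalso
        rw [Fin.lt_def] at hh
        have := hr k.val ((v i).val + 1)
        rw [hrs] at iu iv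
        rw [huv] at *
        split_ifs at * <;> omega
      · exact hh
    have hui' := hui
    rw [Fin.lt_def] at hui'
    have hnb : ¬ BruhatLE u (v * swap k i) := by
      intro hb
      have := (bruhat_iff _ _).mp hb i.val ((v i).val + 1)
      rw [rk_swap_eq _ _ _ hk] at this
      rw [hrs] at iv
      rw [huv] at iu
      split_ifs at * <;> omega
    rw [kl_step hP k i hk hd hui hnb]
    have hmu := hat_move i k (Or.inr hk) hu
    have hmv := hat_move i k (Or.inr hk) hv
    rw [swap_comm] at hmu hmv
    refine ih _ (by omega) _ _ k u' v' rfl ?_ ?_ hmu hmv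
    · simpa using huv
    · rw [invi_eq_rk, invi_eq_rk, rk_swap_ne _ _ _ hk _ _ (by omega),
        rk_swap_ne _ _ _ hk _ _ (by omega)]
      simp only [Perm.mul_apply, swap_apply_left]
      rw [hrs, if_pos (by omega)] at iu iv
      omega
  -- `s` away from `i`
  obtain ⟨a, rfl⟩ := Fin.exists_succAbove_eq (Ne.symm hik)
  obtain ⟨b, rfl⟩ := Fin.exists_succAbove_eq (Ne.symm hik1)
  have hab : b.val = a.val + 1 := by
    rw [sa_val, sa_val] at hk
    have h1 : i.val ≠ (i.succAbove a).val := fun h => hik (Fin.ext h)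
    have h2 : i.val ≠ (i.succAbove b).val := fun h => hik1 (Fin.ext h)
    rw [sa_val] at h1 h2
    split_ifs at * <;> omega
  set s := swap (i.succAbove a) (i.succAbove b) with hs
  set s' := swap a b with hs'
  have hm : ∀ x : Perm (Fin (d + 1)), (x * s) i = x i ∧ invi (x * s) i = invi x i :=
    fun x => invi_mul x i _ _ hk hik hik1
  have hh : ∀ {x : Perm (Fin (d + 1))} {x' : Perm (Fin d)}, IsHat i x x' →
    IsHat i (x * s) (x' * s') := fun h => hat_mul i a b h
  have hlt : ∀ {x : Perm (Fin (d + 1))} {x' : Perm (Fin d)}, IsHat i x x' →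
      (len (x * s) < len x ↔ len (x' * s') < len x') := fun {x x'} h =>
    len_lt_hat (hm x).1.symm (hm x).2.symm h (hh h)
  have hbm : ∃ b b', bmin u (u * s) = b ∧ bmin u' (u' * s') = b' ∧ b i = u i ∧
      invi b i = invi u i ∧ IsHat i b b' := by
    unfold bmin
    have hiff := bruhat_hat (hm u).1.symm hu (hh hu)
    by_cases hc : BruhatLE u (u * s)
    · rw [if_pos hc, if_pos (hiff.mp hc)]
      exact ⟨_, _, rfl, rfl, rfl, rfl, hu⟩
    · rw [if_neg hc, if_neg (fun h => hc (hiff.mpr h))]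
      exact ⟨_, _, rfl, rfl, (hm u).1, (hm u).2, hh hu⟩
  obtain ⟨m, m', hm1, hm2, hm3, hm4, hm5⟩ := hbm
  have hadj : IsAdjTrans s := (adj_iff _).mpr ⟨_, _, hk, rfl⟩
  have hadj' : IsAdjTrans s' := (adj_iff _).mpr ⟨_, _, hab, rfl⟩
  rw [hP.2.2 u v s hadj hld, hP'.2.2 u' v' s' hadj' ((hlt hv).mp hld), hm1, hm2]
  have hvs := hm v
  have t1 : P m (v * s) = P' m' (v' * s') :=
    ih _ (by omega) _ _ i _ _ rfl (by rw [hm3, hvs.1, huv]) (by rw [hm4, hvs.2, hinv]) hm5 (hh hv)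
  have t2 : P (m * s) (v * s) = P' (m' * s') (v' * s') :=
    ih _ (by omega) _ _ i _ _ rfl (by rw [(hm m).1, hm3, hvs.1, huv])
      (by rw [(hm m).2, hm4, hvs.2, hinv]) (hh hm5) (hh hv)
  rw [t1, t2]
  congr 1
  choose lift hl1 hl2 using fun x' : Perm (Fin d) => hat_lift i (v i) x'
  symm
  have hmem : ∀ z', (BruhatLE u' z' ∧ BruhatLE z' (v' * s') ∧ z' ≠ v' * s' ∧
      len (z' * s') < len z') ↔ (BruhatLE u (lift z') ∧ BruhatLE (lift z') (v * s) ∧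
      lift z' ≠ v * s ∧ len (lift z' * s) < len (lift z')) := by
    intro z'
    rw [← bruhat_hat (huv.trans (hl1 z').symm) hu (hl2 z'),
      ← bruhat_hat ((hl1 z').trans hvs.1.symm) (hl2 z') (hh hv), ← hlt (hl2 z')]
    have : z' = v' * s' ↔ lift z' = v * s := by
      constructor
      · intro h
        apply hat_unique' ((hl1 z').trans hvs.1.symm) (hl2 z')
        rw [h]; exact hh hv
      · intro h
        apply hat_unique (hl2 z')
        rw [h]; exact hh hv
    rw [ne_eq, ne_eq, this]
  refine Finset.sum_bij (fun z' _ => lift z') ?_ ?_ ?_ ?_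
  · intro z' hz'
    rw [Finset.mem_filter] at *
    exact ⟨Finset.mem_univ _, (hmem z').mp hz'.2⟩
  · intro x _ y _ hxy
    apply hat_unique (hl2 x)
    rw [hxy]; exact hl2 y
  · intro z hz
    rw [Finset.mem_filter] at hz
    have hsw := sandwich (i := i) hz.2.1 hz.2.2.1 (huv.trans hvs.1.symm) (hinv.trans hvs.2.symm)
    obtain ⟨z', hz'⟩ := hat_exists i z
    have hzz : lift z' = z := hat_unique' (by rw [hl1, hsw.1, hvs.1]) (hl2 z') hz'
    refine ⟨z', ?_, hzz⟩
    rw [Finset.mem_filter]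
    refine ⟨Finset.mem_univ _, (hmem z').mpr ?_⟩
    rw [hzz]; exact hz.2
  · intro z' hz'
    rw [Finset.mem_filter, hmem z'] at hz'
    obtain ⟨-, hz1, hz2, hz3, hz4⟩ := hz'
    have hsw := sandwich (i := i) hz1 hz2 (huv.trans hvs.1.symm) (hinv.trans hvs.2.symm)
    have hlz := bruhat_len hz2
    have q1 : P u (lift z') = P' u' z' :=
      ih _ (by omega) _ _ i _ _ rfl (by rw [hl1, huv]) (by rw [hsw.2, hvs.2, hinv]) hu (hl2 z')
    have q2 : P (lift z') (v * s) = P' z' (v' * s') :=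
      ih _ (by omega) _ _ i _ _ rfl hsw.1 hsw.2 (hl2 z') (hh hv)
    have q3 := len_sub_hat hsw.1 hsw.2 (hl2 z') (hh hv)
    have q4 := len_sub_hat (hsw.1.trans hvs.1) (hsw.2.trans hvs.2) (hl2 z') hv
    unfold klmu
    rw [q1, q2, q3, q4]

/-- if `i` is cancellable for `[y,w]` in `S_{d+1}`, then for all
`u, v` in the Bruhat interval `[y,w]`, `P_{u,v} = P_{u^î, v^î}`, where `P`, `P'`
are the Kazhdan–Lusztig polynomial families of `S_{d+1}` and `S_d`. -/
theorem stmt7 (d : ℕ)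
    (P : Perm (Fin (d + 1)) → Perm (Fin (d + 1)) → Polynomial ℤ)
    (P' : Perm (Fin d) → Perm (Fin d) → Polynomial ℤ)
    (hP : IsKLFamily (d + 1) P) (hP' : IsKLFamily d P')
    (y w : Perm (Fin (d + 1))) (i : Fin (d + 1))
    (hyw : BruhatLE y w) (hval : y i = w i) (hinv : invi y i = invi w i)
    (u v : Perm (Fin (d + 1)))
    (hyu : BruhatLE y u) (huw : BruhatLE u w)
    (hyv : BruhatLE y v) (hvw : BruhatLE v w)
    (u' v' : Perm (Fin d)) (hu' : IsHat i u u') (hv' : IsHat i v v') :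
    P u v = P' u' v' := by
  have h1 := sandwich hyu huw hval hinv
  have h2 := sandwich hyv hvw hval hinv
  exact main_aux d P P' hP hP' _ u v i u' v' rfl (h1.1.trans h2.1.symm) (h1.2.trans h2.2.symm)
    hu' hv'
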